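/- Let I ⊂ (0, +∞) be an interval and consider a family of C² functionals Φ_ρ : E → ℝ of the form Φ_ρ(u) = A(u) − ρ·B(u) for ρ ∈ I, where B(u) ≥ 0 for every u ∈ E, and either A(u) → +∞ or B(u) → +∞ as ‖u‖ → +∞. Suppose Φ'_ρ and Φ''_ρ are α-Hölder continuous on bounded sets for some α ∈ (0, 1]. Suppose moreover there exist w₁, w₂ ∈ S_μ (independent of ρ) such that, setting Γ = {γ ∈ C([0,1], S_μ) : γ(0) = w₁, γ(1) = w₂}, the level c_ρ := inf_{γ ∈ Γ} max_{t ∈ [0,1]} Φ_ρ(γ(t)) satisfies c_ρ > max{Φ_ρ(w₁), Φ_ρ(w₂)} for every ρ ∈ I. Then for Lebesgue-almost every ρ ∈ I there exist a sequence {u_n} ⊂ S_μ and a sequence ζ_n → 0⁺ such that, as n → +∞: (i) Φ_ρ(u_n) → c_ρ; (ii) ‖Φ'_ρ|_{S_μ}(u_n)‖_* → 0; (iii) {u_n} is bounded in E; (iv) the approximate Morse index satisfies m̃_{ζ_n}(u_n) ≤ 1. -/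

import Mathlib

open MeasureTheory Set Filter

/-- A direction `v` along which a functional with first and second derivatives `ℓ`, `Q` decreases,
either to first or to second order. -/
def IsDescent {E : Type*} [NormedAddCommGroup E] [NormedSpace ℝ E]
    (τ δ : ℝ) (ℓ : E →L[ℝ] ℝ) (Q : E →L[ℝ] E →L[ℝ] ℝ) (v : E) : Prop :=
  ‖v‖ ≤ 1 ∧ ℓ v ≤ τ ∧ (ℓ v ≤ -δ ∨ Q v v ≤ -δ)

/-- There is a direction of steep descent, or there are at least two independent directions
of negative curvature. -/
def HasDescent {E : Type*} [NormedAddCommGroup E] [NormedSpace ℝ E]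
    (δ : ℝ) (ℓ : E →L[ℝ] ℝ) (Q : E →L[ℝ] E →L[ℝ] ℝ) : Prop :=
  (∃ v, ‖v‖ ≤ 1 ∧ ℓ v ≤ -δ) ∨ ∀ f : E →L[ℝ] ℝ, ∃ w, ‖w‖ = 1 ∧ f w = 0 ∧ Q w w ≤ -δ

section Descent

variable {E : Type*} [NormedAddCommGroup E] [NormedSpace ℝ E]

lemma IsDescent.of_near {τ δ : ℝ} (hτ : τ ≤ δ / 2)
    {ℓ ℓ' : E →L[ℝ] ℝ} {Q Q' : E →L[ℝ] E →L[ℝ] ℝ} {v : E}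
    (hℓ : ‖ℓ - ℓ'‖ ≤ τ) (hQ : ‖Q - Q'‖ ≤ δ / 2) (h : IsDescent 0 δ ℓ Q v) :
    IsDescent τ (δ / 2) ℓ' Q' v := by
  obtain ⟨hv, h0, h1⟩ := h
  have a1 : |ℓ v - ℓ' v| ≤ τ := by
    have := (ℓ - ℓ').le_of_opNorm_le_of_le hℓ hv
    simpa using this
  have a2 : |Q v v - Q' v v| ≤ δ / 2 := by
    have := (Q - Q').le_of_opNorm₂_le_of_le hQ hv hv
    simpa using this
  rw [abs_le] at a1 a2
  refine ⟨hv, by linarith, ?_⟩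
  rcases h1 with h1 | h1
  · left; linarith
  · right; linarith

lemma IsDescent.exists_segment_of_curvature {δ r Λ : ℝ} (hδ : 0 < δ) (hr : 0 < r) (hr1 : r ≤ 1)
    (hrΛ : r * Λ ≤ δ / 4) {ℓ : E →L[ℝ] ℝ} {Q : E →L[ℝ] E →L[ℝ] ℝ} (hQ : ‖Q‖ ≤ Λ)
    (h : ∀ f : E →L[ℝ] ℝ, ∃ w, ‖w‖ = 1 ∧ f w = 0 ∧ Q w w ≤ -δ) {v : E}
    (hv : IsDescent (δ * r / 32) (δ / 2) ℓ Q v) :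
    ∃ w, IsDescent 0 δ ℓ Q w ∧ ∀ s ∈ Icc (0 : ℝ) 1,
      r * ℓ ((1 - s) • v + s • w) + r ^ 2 / 2 * Q ((1 - s) • v + s • w) ((1 - s) • v + s • w)
        ≤ - (3 * δ * r ^ 2 / 32) := by
  have hΛ : 0 ≤ Λ := (norm_nonneg Q).trans hQ
  have hB : ∀ x y : E, ‖x‖ ≤ 1 → ‖y‖ ≤ 1 → Q x y ≤ Λ := fun x y hx hy =>
    (le_abs_self _).trans (by simpa using Q.le_of_opNorm₂_le_of_le hQ hx hy)
  have hδr2 : 0 < δ * r ^ 2 := by positivity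
  have hδrr : δ * r ^ 2 ≤ δ * r := by nlinarith [mul_pos hδ hr]
  have hr2Λ : r ^ 2 * Λ ≤ δ * r / 4 := by nlinarith
  obtain ⟨hv1, hvτ, hv2⟩ := hv
  obtain ⟨w, hw1, hwf, hwQ, hwℓ⟩ :
      ∃ w, ‖w‖ = 1 ∧ (Q v + Q.flip v) w = 0 ∧ Q w w ≤ -δ ∧ ℓ w ≤ 0 := by
    obtain ⟨w, hw1, hwf, hwQ⟩ := h (Q v + Q.flip v)
    rcases le_total (ℓ w) 0 with hw | hw
    · exact ⟨w, hw1, hwf, hwQ, hw⟩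
    · exact ⟨-w, by simpa using hw1, by rw [map_neg, hwf, neg_zero], by simpa using hwQ,
        by simpa using hw⟩
  refine ⟨w, ⟨hw1.le, hwℓ, Or.inr hwQ⟩, ?_⟩
  rintro s ⟨hs0, hs1⟩
  have e4 := hB v v hv1 hv1
  simp only [add_apply, ContinuousLinearMap.flip_apply] at hwf
  simp only [map_add, map_smul, add_apply, smul_apply,
    smul_eq_mul]
  have hs1' : 0 ≤ 1 - s := by linarith
  have hwf' : Q w v = - Q v w := by linarith
  rw [hwf']
  have d := mul_le_mul_of_nonneg_left hwQ (sq_nonneg s)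
  rcases hv2 with hv2 | hv2
  · have k1 : (1 - s) * ℓ v + s * ℓ w ≤ -(δ / 2) * (1 - s) := by nlinarith
    have k2 : (1 - s) * ((1 - s) * Q v v + s * -Q v w) + s * ((1 - s) * Q v w + s * Q w w)
        ≤ - δ * s ^ 2 + (1 - s) * Λ := by
      have a := mul_le_mul_of_nonneg_left e4 (sq_nonneg (1 - s))
      have b := mul_nonneg (mul_nonneg hs0 hs1') hΛ
      nlinarith
    have k3 := mul_le_mul_of_nonneg_left k1 hr.le
    have k4 := mul_le_mul_of_nonneg_left k2 (by positivity : 0 ≤ r ^ 2 / 2)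
    have k5 := mul_le_mul_of_nonneg_left hr2Λ hs1'
    have k6 := mul_le_mul_of_nonneg_left hδrr hs1'
    linarith [mul_nonneg hδr2.le (sq_nonneg (s - 3 / 8))]
  · have k1 : (1 - s) * ℓ v + s * ℓ w ≤ δ * r / 32 := by
      have := mul_pos hδ hr
      nlinarith
    have k2 : (1 - s) * ((1 - s) * Q v v + s * -Q v w) + s * ((1 - s) * Q v w + s * Q w w)
        ≤ -(δ / 4) := by
      have a := mul_le_mul_of_nonneg_left hv2 (sq_nonneg (1 - s))
      nlinarith [mul_nonneg hδ.le (sq_nonneg (2 * s - 1)), mul_nonneg hδ.le (sq_nonneg s)]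
    have k3 := mul_le_mul_of_nonneg_left k1 hr.le
    have k4 := mul_le_mul_of_nonneg_left k2 (by positivity : 0 ≤ r ^ 2 / 2)
    nlinarith

/-- Any descent direction can be connected by a segment of descent directions of the quadratic
model to a direction with better constants. -/
lemma HasDescent.exists_segment {δ r Λ : ℝ} (hδ : 0 < δ) (hr : 0 < r) (hr1 : r ≤ 1)
    (hrΛ : r * Λ ≤ δ / 4) {ℓ : E →L[ℝ] ℝ} {Q : E →L[ℝ] E →L[ℝ] ℝ} (hQ : ‖Q‖ ≤ Λ)
    (h : HasDescent δ ℓ Q) {v : E} (hv : IsDescent (δ * r / 32) (δ / 2) ℓ Q v) :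
    ∃ w, IsDescent 0 δ ℓ Q w ∧ ∀ s ∈ Icc (0 : ℝ) 1,
      r * ℓ ((1 - s) • v + s • w) + r ^ 2 / 2 * Q ((1 - s) • v + s • w) ((1 - s) • v + s • w)
        ≤ - (3 * δ * r ^ 2 / 32) := by
  have hΛ : 0 ≤ Λ := (norm_nonneg Q).trans hQ
  have hB : ∀ x y : E, ‖x‖ ≤ 1 → ‖y‖ ≤ 1 → Q x y ≤ Λ := fun x y hx hy =>
    (le_abs_self _).trans (by simpa using Q.le_of_opNorm₂_le_of_le hQ hx hy)
  have hδr2 : 0 < δ * r ^ 2 := by positivity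
  have hδrr : δ * r ^ 2 ≤ δ * r := by nlinarith [mul_pos hδ hr]
  have hr2Λ : r ^ 2 * Λ ≤ δ * r / 4 := by nlinarith
  have ⟨hv1, hvτ, hv2⟩ := hv
  rcases h with ⟨w, hw1, hwℓ⟩ | h
  · refine ⟨w, ⟨hw1, by linarith, Or.inl hwℓ⟩, ?_⟩
    rintro s ⟨hs0, hs1⟩
    have e1 := hB v w hv1 hw1
    have e2 := hB w v hw1 hv1
    have e3 := hB w w hw1 hw1
    have e4 := hB v v hv1 hv1
    simp only [map_add, map_smul, add_apply, smul_apply,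
      smul_eq_mul]
    have hs1' : 0 ≤ 1 - s := by linarith
    rcases hv2 with hv2 | hv2
    · have k1 : (1 - s) * ℓ v + s * ℓ w ≤ -(δ / 2) := by nlinarith
      have k2 : (1 - s) * ((1 - s) * Q v v + s * Q w v) + s * ((1 - s) * Q v w + s * Q w w)
          ≤ Λ := by
        have : (1 - s) * Q v v + s * Q w v ≤ Λ := by nlinarith
        have : (1 - s) * Q v w + s * Q w w ≤ Λ := by nlinarith
        nlinarith
      have k3 := mul_le_mul_of_nonneg_left k1 hr.le
      have k4 := mul_le_mul_of_nonneg_left k2 (by positivity : 0 ≤ r ^ 2 / 2)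
      nlinarith
    · have k1 : (1 - s) * ℓ v + s * ℓ w ≤ δ * r / 32 - s * δ := by
        have := mul_pos hδ hr
        nlinarith
      have k2 : (1 - s) * ((1 - s) * Q v v + s * Q w v) + s * ((1 - s) * Q v w + s * Q w w)
          ≤ -(δ / 2) * (1 - s) ^ 2 + 2 * s * Λ := by
        have a := mul_le_mul_of_nonneg_left hv2 (sq_nonneg (1 - s))
        have b := mul_le_mul_of_nonneg_left e1 (mul_nonneg hs0 hs1')
        have c := mul_le_mul_of_nonneg_left e2 (mul_nonneg hs0 hs1')
        have d := mul_le_mul_of_nonneg_left e3 (sq_nonneg s)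
        nlinarith [mul_nonneg (sq_nonneg s) hΛ]
      have k3 := mul_le_mul_of_nonneg_left k1 hr.le
      have k4 := mul_le_mul_of_nonneg_left k2 (by positivity : 0 ≤ r ^ 2 / 2)
      have k5 := mul_le_mul_of_nonneg_left hr2Λ hs0
      have k6 := mul_le_mul_of_nonneg_left hδrr hs0
      nlinarith [mul_nonneg hδr2.le (sq_nonneg s)]
  · exact hv.exists_segment_of_curvature hδ hr hr1 hrΛ hQ h

lemma IsDescent.model_le {δ r Λ : ℝ} (hδ : 0 < δ) (hr : 0 < r) (hr1 : r ≤ 1)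
    (hrΛ : r * Λ ≤ δ / 4) {ℓ : E →L[ℝ] ℝ} {Q : E →L[ℝ] E →L[ℝ] ℝ} (hQ : ‖Q‖ ≤ Λ)
    {v : E} (hv : IsDescent (δ * r / 32) (δ / 2) ℓ Q v) :
    r * ℓ v + r ^ 2 / 2 * Q v v ≤ - (3 * δ * r ^ 2 / 32) := by
  obtain ⟨hv1, hvτ, hv2⟩ := hv
  have e4 : Q v v ≤ Λ :=
    (le_abs_self _).trans (by simpa using Q.le_of_opNorm₂_le_of_le hQ hv1 hv1)
  have hδr2 : 0 < δ * r ^ 2 := by positivity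
  have hδrr : δ * r ^ 2 ≤ δ * r := by nlinarith [mul_pos hδ hr]
  have hr2Λ : r ^ 2 * Λ ≤ δ * r / 4 := by nlinarith
  rcases hv2 with hv2 | hv2
  · have k4 := mul_le_mul_of_nonneg_left e4 (by positivity : 0 ≤ r ^ 2 / 2)
    have k3 := mul_le_mul_of_nonneg_left hv2 hr.le
    nlinarith
  · have k4 := mul_le_mul_of_nonneg_left hv2 (by positivity : 0 ≤ r ^ 2 / 2)
    have k3 := mul_le_mul_of_nonneg_left hvτ hr.le
    nlinarith

lemma IsDescent.model_nonpos {δ r Λ : ℝ} (hδ : 0 < δ) (hr1 : r ≤ 1)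
    (hrΛ : r * Λ ≤ δ / 4) {ℓ : E →L[ℝ] ℝ} {Q : E →L[ℝ] E →L[ℝ] ℝ} (hQ : ‖Q‖ ≤ Λ)
    {v : E} (hv : IsDescent 0 δ ℓ Q v) {s : ℝ} (hs : 0 ≤ s) (hsr : s ≤ r) :
    s * ℓ v + s ^ 2 / 2 * Q v v + δ / 32 * s ^ 2 ≤ 0 := by
  obtain ⟨hv1, hvτ, hv2⟩ := hv
  have hΛ : 0 ≤ Λ := (norm_nonneg Q).trans hQ
  have e4 : Q v v ≤ Λ :=
    (le_abs_self _).trans (by simpa using Q.le_of_opNorm₂_le_of_le hQ hv1 hv1)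
  have hsΛ : s * Λ ≤ δ / 4 := by nlinarith
  have h0 : 0 ≤ δ * s := by positivity
  have hδss : δ * s ^ 2 ≤ δ * s := by nlinarith
  rcases hv2 with hv2 | hv2
  · have k4 := mul_le_mul_of_nonneg_left e4 (by positivity : 0 ≤ s ^ 2 / 2)
    have k3 := mul_le_mul_of_nonneg_left hv2 hs
    nlinarith
  · have k4 := mul_le_mul_of_nonneg_left hv2 (by positivity : 0 ≤ s ^ 2 / 2)
    have k3 := mul_le_mul_of_nonneg_left hvτ hs
    nlinarith [mul_nonneg hδ.le (sq_nonneg s)]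

end Descent

/-- Deformation of a curve whose values exceed `c` only slightly: if near the level `c` every
point has descent directions in the sense of `HasDescent`, then the end points can be
joined below the level `c`. -/
theorem exists_joinedIn_sublevel {X E : Type*} [TopologicalSpace X]
    [NormedAddCommGroup E] [NormedSpace ℝ E]
    {f : X → ℝ} (hf : Continuous f) {ℓ : X → E →L[ℝ] ℝ} (hℓ : Continuous ℓ)
    {Q : X → E →L[ℝ] E →L[ℝ] ℝ} (hQ : Continuous Q)
    {Θ : X → E → X} (hΘ : Continuous fun p : X × E => Θ p.1 p.2) (hΘ0 : ∀ x, Θ x 0 = x)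
    {D : Set X} {Λ δ c : ℝ} (hδ : 0 < δ) (hΛ : ∀ x ∈ D, ‖Q x‖ ≤ Λ)
    (hexp : ∀ η > 0, ∃ r > 0, ∀ x ∈ D, ∀ v : E, ‖v‖ ≤ 1 → ∀ s : ℝ, 0 ≤ s → s ≤ r →
      f (Θ x (s • v)) ≤ f x + (s * ℓ x v + s ^ 2 / 2 * Q x v v) + η * s ^ 2)
    (hD : ∀ x ∈ D, |f x - c| ≤ δ → HasDescent δ (ℓ x) (Q x)) :
    ∃ ε > 0, ∀ ε' > 0, ∀ g : ℝ → X, Continuous g → (∀ t, f (g t) ≤ c + ε) →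
      (∀ t, c - ε' < f (g t) → g t ∈ D) → ∀ a b, f (g a) < c → f (g b) < c →
      JoinedIn {x | f x < c} (g a) (g b) := by
  obtain ⟨r₀, hr₀, hexp⟩ := hexp (δ / 32) (by positivity)
  obtain ⟨r, hr, hrr₀, hr1, hrΛ⟩ : ∃ r : ℝ, 0 < r ∧ r ≤ r₀ ∧ r ≤ 1 ∧ r * Λ ≤ δ / 4 := by
    refine ⟨min r₀ (min 1 (δ / (4 * (|Λ| + 1)))), by positivity, min_le_left _ _,
      (min_le_right _ _).trans (min_le_left _ _), ?_⟩
    have h1 : min r₀ (min 1 (δ / (4 * (|Λ| + 1)))) ≤ δ / (4 * (|Λ| + 1)) :=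
      (min_le_right _ _).trans (min_le_right _ _)
    have h2 : δ / (4 * (|Λ| + 1)) * (|Λ| + 1) = δ / 4 := by
      have : |Λ| + 1 ≠ 0 := by positivity
      field_simp
    have h0 : 0 ≤ min r₀ (min 1 (δ / (4 * (|Λ| + 1)))) := by positivity
    calc _ ≤ min r₀ (min 1 (δ / (4 * (|Λ| + 1)))) * (|Λ| + 1) := by
          gcongr; linarith [le_abs_self Λ]
      _ ≤ δ / (4 * (|Λ| + 1)) * (|Λ| + 1) := by gcongr
      _ = _ := h2
  have hδr2 : 0 < δ * r ^ 2 := by positivity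
  have hδr : δ * r ≤ δ := by nlinarith
  have hδr2' : δ * r ^ 2 ≤ δ := by nlinarith
  refine ⟨δ * r ^ 2 / 32, by positivity, fun ε' hε' g hg hgc hgD a b ha hb => ?_⟩
  set S := {x | f x < c} with hS
  set τ := δ * r / 32 with hτ
  have hτ0 : 0 < τ := by positivity
  -- a strong descent direction moves points below `c` within the sublevel set
  have retreat : ∀ x ∈ D, f x < c → ∀ v, IsDescent 0 δ (ℓ x) (Q x) v →
      JoinedIn S x (Θ x (r • v)) := by
    intro x hxD hx v hv
    have hc : Continuous fun s : ℝ => Θ x ((s * r) • v) :=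
      hΘ.comp (by fun_prop : Continuous fun s : ℝ => (x, (s * r) • v))
    refine JoinedIn.ofLine hc.continuousOn (by simp [hΘ0]) (by simp) ?_
    rintro _ ⟨s, ⟨hs0, hs1⟩, rfl⟩
    have h0 : 0 ≤ s * r := by positivity
    have h1 : s * r ≤ r := by nlinarith
    have := hexp x hxD v hv.1 (s * r) h0 (h1.trans hrr₀)
    have := hv.model_nonpos hδ hr1 hrΛ (hΛ x hxD) h0 h1
    simp only [hS, mem_ofPred_eq]
    linarith
  -- moving along a weak descent direction
  have push : ∀ x ∈ D, f x ≤ c + δ * r ^ 2 / 32 → ∀ v,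
      IsDescent τ (δ / 2) (ℓ x) (Q x) v → Θ x (r • v) ∈ S := by
    intro x hxD hx v hv
    have := hexp x hxD v hv.1 r hr.le hrr₀
    have := hv.model_le hδ hr hr1 hrΛ (hΛ x hxD)
    simp only [hS, mem_ofPred_eq]
    linarith
  have turn : ∀ x ∈ D, f x ≤ c + δ * r ^ 2 / 32 → HasDescent δ (ℓ x) (Q x) → ∀ v,
      IsDescent τ (δ / 2) (ℓ x) (Q x) v → ∃ w, IsDescent 0 δ (ℓ x) (Q x) w ∧
        JoinedIn S (Θ x (r • v)) (Θ x (r • w)) := by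
    intro x hxD hx hH v hv
    obtain ⟨w, hw, h⟩ := hH.exists_segment hδ hr hr1 hrΛ (hΛ x hxD) hv
    have hc : Continuous fun s : ℝ => Θ x (r • ((1 - s) • v + s • w)) :=
      hΘ.comp (by fun_prop : Continuous fun s : ℝ => (x, r • ((1 - s) • v + s • w)))
    refine ⟨w, hw, JoinedIn.ofLine hc.continuousOn (by simp) (by simp) ?_⟩
    rintro _ ⟨s, ⟨hs0, hs1⟩, rfl⟩
    have hn : ‖(1 - s) • v + s • w‖ ≤ 1 := by
      have : (1 - s) • v + s • w ∈ Metric.closedBall (0 : E) 1 :=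
        convex_closedBall 0 1 (by simpa using hv.1) (by simpa using hw.1) (by linarith) hs0
          (by ring)
      simpa using this
    have := hexp x hxD _ hn r hr.le hrr₀
    have := h s ⟨hs0, hs1⟩
    simp only [hS, mem_ofPred_eq]
    linarith
  have exists_descent : ∀ x ∈ D, HasDescent δ (ℓ x) (Q x) →
      ∃ w, IsDescent 0 δ (ℓ x) (Q x) w := by
    rintro x hxD (⟨w, hw1, hw⟩ | h)
    · exact ⟨w, hw1, by linarith, Or.inl hw⟩
    · obtain ⟨w, hw1, hwf, hwQ⟩ := h (ℓ x)
      exact ⟨w, hw1.le, hwf.le, Or.inr hwQ⟩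
  let T : ℝ → Prop := fun t => (f (g t) < c ∧ JoinedIn S (g a) (g t)) ∨
    ∃ v, g t ∈ D ∧ IsDescent 0 δ (ℓ (g t)) (Q (g t)) v ∧ JoinedIn S (g a) (Θ (g t) (r • v))
  have T_low : ∀ t, f (g t) < c → T t → JoinedIn S (g a) (g t) := by
    rintro t ht (h | ⟨v, hD, hv, h⟩)
    · exact h.2
    · exact h.trans (retreat _ hD ht v hv).symm
  have line : ∀ {t η s s' : ℝ}, s ∈ Metric.ball t η → s' ∈ Metric.ball t η →
      ∀ σ ∈ Icc (0 : ℝ) 1, (1 - σ) * s + σ * s' ∈ Metric.ball t η := by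
    rintro t η s s' hs hs' σ ⟨h0, h1⟩
    exact convex_ball t η hs hs' (by linarith) h0 (by ring)
  have local_step : ∀ t, ∀ᶠ s in nhds t, (T t → T s) ∧ (T s → T t) := by
    intro t
    by_cases ht : f (g t) < c
    · have ho : ∀ᶠ s in nhds t, f (g s) < c :=
        (hf.comp hg).continuousAt.eventually_lt_const ht
      obtain ⟨η, hη, hball⟩ := Metric.eventually_nhds_iff_ball.1 ho
      have key : ∀ s ∈ Metric.ball t η, ∀ s' ∈ Metric.ball t η, T s → T s' := by
        intro s hs s' hs' h
        refine Or.inl ⟨hball _ hs', (T_low s (hball _ hs) h).trans ?_⟩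
        refine JoinedIn.ofLine (f := fun σ : ℝ => g ((1 - σ) * s + σ * s'))
          (hg.comp (by fun_prop)).continuousOn (by simp) (by simp) ?_
        rintro _ ⟨σ, hσ, rfl⟩
        exact hball _ (line hs hs' σ hσ)
      filter_upwards [Metric.ball_mem_nhds t hη] with s hs
      exact ⟨key _ (Metric.mem_ball_self hη) _ hs, key _ hs _ (Metric.mem_ball_self hη)⟩
    · push Not at ht
      have o1 : ∀ᶠ s in nhds t, c - min ε' δ < f (g s) :=
        (hf.comp hg).continuousAt.eventually_const_lt
          (by have := lt_min hε' hδ; simp only [Function.comp]; linarith)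
      have o2 : ∀ᶠ s in nhds t, dist (ℓ (g s)) (ℓ (g t)) < τ / 2 :=
        Metric.tendsto_nhds.1 (hℓ.comp hg).continuousAt _ (by positivity)
      have o3 : ∀ᶠ s in nhds t, dist (Q (g s)) (Q (g t)) < δ / 4 :=
        by
        have hQg : Continuous fun s => Q (g s) := hQ.comp hg
        have := hQg.tendsto t
        exact Metric.tendsto_nhds.1 this _ (by positivity)
      obtain ⟨η, hη, hball⟩ := Metric.eventually_nhds_iff_ball.1 (o1.and (o2.and o3))
      have hDs : ∀ s ∈ Metric.ball t η, g s ∈ D := fun s hs =>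
        hgD s (by have := (hball s hs).1; have := min_le_left ε' δ; linarith)
      have hHs : ∀ s ∈ Metric.ball t η, HasDescent δ (ℓ (g s)) (Q (g s)) := fun s hs => by
        refine hD _ (hDs s hs) (abs_le.2 ⟨?_, ?_⟩)
        · have := (hball s hs).1; have := min_le_right ε' δ; linarith
        · have := hgc s; linarith
      have weak : ∀ s ∈ Metric.ball t η, ∀ s' ∈ Metric.ball t η, ∀ v,
          IsDescent 0 δ (ℓ (g s)) (Q (g s)) v →
          IsDescent τ (δ / 2) (ℓ (g s')) (Q (g s')) v := by
        intro s hs s' hs' v hv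
        refine hv.of_near (by rw [hτ]; linarith) ?_ ?_
        · rw [← dist_eq_norm]
          have := (hball s hs).2.1
          have := (hball s' hs').2.1
          have := dist_triangle_right (ℓ (g s)) (ℓ (g s')) (ℓ (g t))
          linarith
        · have h1 := (hball s hs).2.2
          have h2 := (hball s' hs').2.2
          rw [dist_comm] at h2
          have h3 := norm_sub_le_norm_sub_add_norm_sub (Q (g s)) (Q (g t)) (Q (g s'))
          have h4 := dist_eq_norm (Q (g s)) (Q (g t))
          have h5 := dist_eq_norm (Q (g t)) (Q (g s'))
          linarith
      have key : ∀ s ∈ Metric.ball t η, ∀ s' ∈ Metric.ball t η, T s → T s' := by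
        intro s hs s' hs' h
        obtain ⟨v, hv, hj⟩ : ∃ v, IsDescent 0 δ (ℓ (g s)) (Q (g s)) v ∧
            JoinedIn S (g a) (Θ (g s) (r • v)) := by
          rcases h with h | ⟨v, -, hv, hj⟩
          · obtain ⟨v, hv⟩ := exists_descent _ (hDs s hs) (hHs s hs)
            exact ⟨v, hv, h.2.trans (retreat _ (hDs s hs) h.1 v hv)⟩
          · exact ⟨v, hv, hj⟩
        obtain ⟨w, hw, hjw⟩ := turn _ (hDs s' hs') (hgc s') (hHs s' hs') v (weak s hs s' hs' v hv)
        refine Or.inr ⟨w, hDs s' hs', hw, (hj.trans ?_).trans hjw⟩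
        have hc : Continuous fun σ : ℝ => Θ (g ((1 - σ) * s + σ * s')) (r • v) :=
          hΘ.comp (((hg.comp (by fun_prop : Continuous fun σ : ℝ =>
            (1 - σ) * s + σ * s'))).prodMk continuous_const)
        refine JoinedIn.ofLine hc.continuousOn (by simp) (by simp) ?_
        rintro _ ⟨σ, hσ, rfl⟩
        have hl := line hs hs' σ hσ
        exact push _ (hDs _ hl) (hgc _) v (weak s hs _ hl v hv)
      filter_upwards [Metric.ball_mem_nhds t hη] with s hs
      exact ⟨key _ (Metric.mem_ball_self hη) _ hs, key _ hs _ (Metric.mem_ball_self hη)⟩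
  have hT := PreconnectedSpace.induction₂' (fun s t => T s → T t) local_step
    ⟨fun _ _ _ h h' hs => h' (h hs)⟩ a b
  exact T_low b hb (hT (Or.inl ⟨ha, JoinedIn.refl ha⟩))

/-- Second-order Taylor estimate, with the oscillation of the second derivative as error. -/
lemma abs_taylor_two_sub_le {E : Type*} [NormedAddCommGroup E] [NormedSpace ℝ E]
    {f : E → ℝ} (hf : ContDiff ℝ 2 f) {u h : E} {η : ℝ} (hη : 0 ≤ η)
    (hosc : ∀ x, ‖x - u‖ ≤ ‖h‖ → ‖fderiv ℝ (fderiv ℝ f) x - fderiv ℝ (fderiv ℝ f) u‖ ≤ η) :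
    |f (u + h) - f u - fderiv ℝ f u h - fderiv ℝ (fderiv ℝ f) u h h / 2| ≤ η * ‖h‖ ^ 2 := by
  have hd1 : Differentiable ℝ f := hf.differentiable (by norm_num)
  have hd2 : Differentiable ℝ (fderiv ℝ f) :=
    (hf.fderiv_right (m := 1) (by norm_num)).differentiable (by norm_num)
  have key : ∀ x, ‖x - u‖ ≤ ‖h‖ →
      ‖fderiv ℝ f x - fderiv ℝ f u - fderiv ℝ (fderiv ℝ f) u (x - u)‖ ≤ η * ‖h‖ := by
    intro x hx
    have hc : Convex ℝ (Metric.closedBall u ‖h‖) := convex_closedBall _ _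
    have := hc.norm_image_sub_le_of_norm_fderiv_le' (𝕜 := ℝ) (f := fderiv ℝ f)
      (φ := fderiv ℝ (fderiv ℝ f) u) (C := η) (fun y _ => hd2 y)
      (fun y hy => hosc y (by simpa [dist_eq_norm] using hy))
      (Metric.mem_closedBall_self (norm_nonneg h)) (by simpa [dist_eq_norm] using hx)
    exact this.trans (by gcongr)
  set a := fderiv ℝ f u h with ha
  set b := fderiv ℝ (fderiv ℝ f) u h h with hb
  let g : ℝ → ℝ := fun t => f (u + t • h) - t * a - t ^ 2 / 2 * b
  have hg : ∀ t : ℝ, HasDerivAt g (fderiv ℝ f (u + t • h) h - a - t * b) t := by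
    intro t
    have h1 : HasDerivAt (fun t : ℝ => u + t • h) h t := by
      simpa using ((hasDerivAt_id t).smul_const h).const_add u
    have h2 := (hd1 (u + t • h)).hasFDerivAt.comp_hasDerivAt t h1
    have h3 := ((h2.sub ((hasDerivAt_id t).mul_const a))).sub
      ((((hasDerivAt_id t).pow 2).div_const 2).mul_const b)
    have h4 : fderiv ℝ f (u + t • h) h - a - t * b = fderiv ℝ f (u + t • h) h - 1 * a
        - ((2 : ℕ) : ℝ) * id t ^ (2 - 1) * 1 / 2 * b := by simp
    rw [h4]
    exact h3
  have hb : ∀ t ∈ Icc (0 : ℝ) 1, ‖fderiv ℝ f (u + t • h) h - a - t * b‖ ≤ η * ‖h‖ * ‖h‖ := by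
    intro t ht
    have h1 : ‖u + t • h - u‖ ≤ ‖h‖ := by
      rw [add_sub_cancel_left, norm_smul, Real.norm_of_nonneg ht.1]
      nlinarith [norm_nonneg h, ht.2]
    have h2 := ContinuousLinearMap.le_of_opNorm_le _ (key _ h1) h
    simpa [ha, hb] using h2
  have := (convex_Icc (0 : ℝ) 1).norm_image_sub_le_of_norm_hasDerivWithin_le
    (fun t _ => (hg t).hasDerivWithinAt) hb (left_mem_Icc.2 zero_le_one)
    (right_mem_Icc.2 zero_le_one)
  simp only [g] at this
  rw [Real.norm_eq_abs] at this
  convert this using 1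
  · congr 1
    simp
    ring
  · norm_num
    ring

section Constraint

variable {E H : Type*} [NormedAddCommGroup E] [InnerProductSpace ℝ E]
  [NormedAddCommGroup H] [InnerProductSpace ℝ H] (ι : E →L[ℝ] H) (μ : ℝ)

/-- The projection onto the tangent space at `u` of `{‖ι u‖ ^ 2 = μ}`, along `u`. -/
noncomputable def tangentProj (u : E) : E →L[ℝ] E :=
  ContinuousLinearMap.id ℝ E - (μ⁻¹ • ((innerSL ℝ (ι u)).comp ι)).smulRight u

/-- Stereographic motion on `{‖ι u‖ ^ 2 = μ}` from `u` in the tangent direction `w`. -/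
noncomputable def slide (u w : E) : E :=
  (1 + ‖ι w‖ ^ 2 / (4 * μ))⁻¹ • ((1 - ‖ι w‖ ^ 2 / (4 * μ)) • u + w)

variable {ι μ}

lemma tangentProj_apply (u v : E) :
    tangentProj ι μ u v = v - (μ⁻¹ * inner ℝ (ι u) (ι v)) • u := by
  simp [tangentProj]

lemma inner_tangentProj (hμ : 0 < μ) {u : E} (hu : ‖ι u‖ ^ 2 = μ) (v : E) :
    inner ℝ (ι u) (ι (tangentProj ι μ u v)) = 0 := by
  rw [tangentProj_apply, map_sub, map_smul, inner_sub_right, inner_smul_right,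
    real_inner_self_eq_norm_sq, hu]
  field_simp
  ring

lemma tangentProj_eq_self {u v : E} (h : inner ℝ (ι u) (ι v) = 0) :
    tangentProj ι μ u v = v := by
  simp [tangentProj_apply, h]

lemma continuous_tangentProj : Continuous (tangentProj ι μ) := by
  unfold tangentProj
  fun_prop

lemma norm_tangentProj_le (hι : ∀ v : E, ‖ι v‖ ≤ ‖v‖) (hμ : 0 < μ) {u v : E} (hv : ‖v‖ ≤ 1) :
    ‖tangentProj ι μ u v‖ ≤ 1 + μ⁻¹ * ‖u‖ ^ 2 := by
  rw [tangentProj_apply]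
  refine (norm_sub_le _ _).trans (add_le_add hv ?_)
  rw [norm_smul, norm_mul, norm_inv, Real.norm_of_nonneg hμ.le, mul_assoc]
  gcongr
  have h1 : ‖(inner ℝ (ι u) (ι v) : ℝ)‖ ≤ ‖u‖ * 1 :=
    (norm_inner_le_norm _ _).trans (mul_le_mul (hι u) ((hι v).trans hv) (norm_nonneg _)
      (norm_nonneg _))
  nlinarith [norm_nonneg u]

lemma norm_slide (hμ : 0 < μ) {u w : E} (hu : ‖ι u‖ ^ 2 = μ)
    (hw : inner ℝ (ι u) (ι w) = 0) : ‖ι (slide ι μ u w)‖ ^ 2 = μ := by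
  have h1 : ‖(1 - ‖ι w‖ ^ 2 / (4 * μ)) • ι u + ι w‖ ^ 2 = (1 + ‖ι w‖ ^ 2 / (4 * μ)) ^ 2 * μ := by
    rw [norm_add_sq_real, inner_smul_left, hw, norm_smul, mul_pow, hu, Real.norm_eq_abs, sq_abs]
    field_simp
    ring
  have h2 : 0 < 1 + ‖ι w‖ ^ 2 / (4 * μ) := by positivity
  rw [slide, map_smul, map_add, map_smul, norm_smul, mul_pow, h1, norm_inv, Real.norm_eq_abs,
    inv_pow, sq_abs]
  field_simp

lemma slide_zero (u : E) : slide ι μ u 0 = u := by simp [slide]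

lemma continuous_slide (hμ : 0 < μ) : Continuous fun p : E × E => slide ι μ p.1 p.2 := by
  unfold slide
  have : ∀ p : E × E, 1 + ‖ι p.2‖ ^ 2 / (4 * μ) ≠ 0 := fun p => by positivity
  fun_prop (disch := exact this)

lemma slide_sub (hμ : 0 < μ) (u w : E) : slide ι μ u w - u =
    (1 + ‖ι w‖ ^ 2 / (4 * μ))⁻¹ • (w - (2 * (‖ι w‖ ^ 2 / (4 * μ))) • u) := by
  have h2 : 1 + ‖ι w‖ ^ 2 / (4 * μ) ≠ 0 := by positivity
  rw [slide]
  generalize ‖ι w‖ ^ 2 / (4 * μ) = y at *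
  apply smul_right_injective E h2
  simp only [smul_sub, smul_inv_smul₀ h2]
  module

/-- Expansion of `f` along `slide`. -/
lemma exists_apply_slide_le (hι : ∀ v : E, ‖ι v‖ ≤ ‖v‖) (hμ : 0 < μ)
    {f : E → ℝ} (hf : ContDiff ℝ 2 f) {K Λ₁ Λ₂ : ℝ} (hK : 0 ≤ K)
    (h₁ : ∀ u, ‖u‖ ≤ K → ‖fderiv ℝ f u‖ ≤ Λ₁)
    (h₂ : ∀ u, ‖u‖ ≤ K → ‖fderiv ℝ (fderiv ℝ f) u‖ ≤ Λ₂) :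
    ∃ C > 0, ∀ u w : E, ‖u‖ ≤ K → ‖w‖ ≤ 1 → ∀ η ≥ 0,
      (∀ x, ‖x - u‖ ≤ C * ‖w‖ → ‖fderiv ℝ (fderiv ℝ f) x - fderiv ℝ (fderiv ℝ f) u‖ ≤ η) →
      f (slide ι μ u w) ≤ f u + fderiv ℝ f u w +
        (fderiv ℝ (fderiv ℝ f) u w w - fderiv ℝ f u u / μ * ‖ι w‖ ^ 2) / 2 +
        C * ‖w‖ ^ 3 + η * C * ‖w‖ ^ 2 := by
  have hΛ₁ : 0 ≤ Λ₁ := (norm_nonneg _).trans (h₁ 0 (by simpa using hK))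
  have hΛ₂ : 0 ≤ Λ₂ :=
    (norm_nonneg (fderiv ℝ (fderiv ℝ f) 0)).trans (h₂ 0 (by simpa using hK))
  set b := 1 + K / (2 * μ) with hb
  have hb1 : 1 ≤ b := by rw [hb]; have : 0 ≤ K / (2 * μ) := by positivity
                         linarith
  set d := K / (2 * μ) + b / (4 * μ) with hd
  have hd0 : 0 ≤ d := by positivity
  refine ⟨b ^ 2 + (Λ₁ * (b / (4 * μ)) + Λ₂ * (d * (b + 1)) / 2), by positivity,
    fun u w hu hw η hη hosc => ?_⟩
  set C := b ^ 2 + (Λ₁ * (b / (4 * μ)) + Λ₂ * (d * (b + 1)) / 2) with hC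
  have hCb : b ≤ C := by
    have : 0 ≤ Λ₁ * (b / (4 * μ)) + Λ₂ * (d * (b + 1)) / 2 := by positivity
    nlinarith
  set y := ‖ι w‖ ^ 2 / (4 * μ) with hy
  have hy0 : 0 ≤ y := by positivity
  have hyw : y ≤ ‖w‖ ^ 2 / (4 * μ) := by rw [hy]; gcongr; exact hι w
  have hw2 : ‖w‖ ^ 2 ≤ ‖w‖ := by nlinarith [norm_nonneg w]
  set k := w - (2 * y) • u with hk
  set h := slide ι μ u w - u with hh
  have hhk : h = (1 + y)⁻¹ • k := slide_sub hμ u w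
  have h2y : ‖(2 * y) • u‖ ≤ ‖w‖ ^ 2 * (K / (2 * μ)) := by
    rw [norm_smul, Real.norm_of_nonneg (by positivity)]
    calc 2 * y * ‖u‖ ≤ 2 * (‖w‖ ^ 2 / (4 * μ)) * K := by gcongr
      _ = _ := by field_simp; ring
  have hkn : ‖k‖ ≤ b * ‖w‖ := by
    calc ‖k‖ ≤ ‖w‖ + ‖(2 * y) • u‖ := norm_sub_le _ _
      _ ≤ ‖w‖ + ‖w‖ * (K / (2 * μ)) := by
        gcongr
        exact h2y.trans (by gcongr)
      _ = _ := by rw [hb]; ring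
  have hhn : ‖h‖ ≤ b * ‖w‖ := by
    rw [hhk, norm_smul, norm_inv, Real.norm_of_nonneg (by positivity)]
    refine le_trans ?_ hkn
    exact mul_le_of_le_one_left (norm_nonneg _) (inv_le_one_of_one_le₀ (by linarith))
  set e := k - h with he
  have hen : ‖e‖ ≤ ‖w‖ ^ 3 * (b / (4 * μ)) := by
    have hek : e = y • h := by
      have : k = (1 + y) • h := by rw [hhk, smul_inv_smul₀ (by positivity)]
      rw [he, this]; module
    rw [hek, norm_smul, Real.norm_of_nonneg hy0]
    calc y * ‖h‖ ≤ ‖w‖ ^ 2 / (4 * μ) * (b * ‖w‖) := by gcongr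
      _ = _ := by ring
  have hhw : ‖h - w‖ ≤ ‖w‖ ^ 2 * d := by
    have : h - w = -((2 * y) • u) - e := by rw [he, hk]; module
    rw [this]
    refine (norm_sub_le _ _).trans ?_
    rw [norm_neg, hd, mul_add]
    refine add_le_add h2y (hen.trans ?_)
    have := norm_nonneg w
    gcongr ?_ * _
    nlinarith
  have hT := abs_taylor_two_sub_le hf (u := u) (h := h) hη
    (fun x hx => hosc x (hx.trans (hhn.trans (by gcongr))))
  have hℓ : fderiv ℝ f u h ≤ fderiv ℝ f u w - fderiv ℝ f u u / μ * ‖ι w‖ ^ 2 / 2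
      + Λ₁ * (b / (4 * μ)) * ‖w‖ ^ 3 := by
    have h3 : h = w - (2 * y) • u - e := by rw [he, hk]; module
    have h4 : |fderiv ℝ f u e| ≤ Λ₁ * (‖w‖ ^ 3 * (b / (4 * μ))) :=
      (fderiv ℝ f u).le_of_opNorm_le_of_le (h₁ u hu) hen
    have h5 := neg_abs_le (fderiv ℝ f u e)
    rw [h3, map_sub, map_sub, map_smul, smul_eq_mul]
    have h6 : 2 * y * fderiv ℝ f u u = fderiv ℝ f u u / μ * ‖ι w‖ ^ 2 / 2 := by
      rw [hy]; field_simp; ring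
    rw [h6]
    linarith
  have hq : fderiv ℝ (fderiv ℝ f) u h h ≤ fderiv ℝ (fderiv ℝ f) u w w
      + Λ₂ * (d * (b + 1)) * ‖w‖ ^ 3 := by
    set q := fderiv ℝ (fderiv ℝ f) u
    have h3 : q h h = q w w + q (h - w) h + q w (h - w) := by
      simp only [map_sub, sub_apply]; ring
    have h4 : q (h - w) h ≤ Λ₂ * (‖w‖ ^ 2 * d) * (b * ‖w‖) :=
      (le_abs_self _).trans (q.le_of_opNorm₂_le_of_le (h₂ u hu) hhw hhn)
    have h5 : q w (h - w) ≤ Λ₂ * ‖w‖ * (‖w‖ ^ 2 * d) :=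
      (le_abs_self _).trans (q.le_of_opNorm₂_le_of_le (h₂ u hu) le_rfl hhw)
    rw [h3]
    linarith
  have hh2 : η * ‖h‖ ^ 2 ≤ η * C * ‖w‖ ^ 2 := by
    have : ‖h‖ ^ 2 ≤ (b * ‖w‖) ^ 2 := by gcongr
    have h7 : b ^ 2 ≤ C := by
      have : 0 ≤ Λ₁ * (b / (4 * μ)) + Λ₂ * (d * (b + 1)) / 2 := by positivity
      linarith
    calc η * ‖h‖ ^ 2 ≤ η * (b * ‖w‖) ^ 2 := by gcongr
      _ = η * b ^ 2 * ‖w‖ ^ 2 := by ring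
      _ ≤ _ := by gcongr
  have huh : u + h = slide ι μ u w := by rw [hh]; abel
  rw [huh] at hT
  have h8 := (abs_le.1 hT).2
  have h9 : 0 ≤ b ^ 2 * ‖w‖ ^ 3 := by positivity
  have h10 : C * ‖w‖ ^ 3 = b ^ 2 * ‖w‖ ^ 3 + Λ₁ * (b / (4 * μ)) * ‖w‖ ^ 3
      + Λ₂ * (d * (b + 1)) * ‖w‖ ^ 3 / 2 := by rw [hC]; ring
  rw [h10]
  linarith

end Constraint

section ConstraintDeformation

variable {E H : Type*} [NormedAddCommGroup E] [InnerProductSpace ℝ E]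
  [NormedAddCommGroup H] [InnerProductSpace ℝ H] (ι : E →L[ℝ] H) (μ : ℝ)

/-- The derivative of `f` along `{‖ι u‖ ^ 2 = μ}`, extended to all directions. -/
noncomputable def tangentGrad (f : E → ℝ) (u : E) : E →L[ℝ] ℝ :=
  (fderiv ℝ f u).comp (tangentProj ι μ u)

/-- The free Hessian of `f` on `{‖ι u‖ ^ 2 = μ}` with its Lagrange multiplier term. -/
noncomputable def lagrangeHess (f : E → ℝ) (u : E) : E →L[ℝ] E →L[ℝ] ℝ :=
  let G : H →L[ℝ] H →L[ℝ] ℝ := innerSL ℝ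
  fderiv ℝ (fderiv ℝ f) u - (fderiv ℝ f u u / μ) • G.bilinearComp ι ι

/-- The second derivative of `f` along `{‖ι u‖ ^ 2 = μ}`, extended to all directions. -/
noncomputable def tangentHess (f : E → ℝ) (u : E) : E →L[ℝ] E →L[ℝ] ℝ :=
  (((lagrangeHess ι μ f u).comp (tangentProj ι μ u)).flip.comp (tangentProj ι μ u)).flip

variable {ι μ}

lemma lagrangeHess_apply (f : E → ℝ) (u v w : E) :
    lagrangeHess ι μ f u v w = fderiv ℝ (fderiv ℝ f) u v w
      - fderiv ℝ f u u / μ * inner ℝ (ι v) (ι w) := by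
  simp only [lagrangeHess, sub_apply, smul_apply, smul_eq_mul]
  rfl

lemma tangentHess_apply (f : E → ℝ) (u v w : E) :
    tangentHess ι μ f u v w
      = lagrangeHess ι μ f u (tangentProj ι μ u v) (tangentProj ι μ u w) := by
  simp [tangentHess]

lemma continuous_tangentGrad {f : E → ℝ} (hf : ContDiff ℝ 2 f) :
    Continuous (tangentGrad ι μ f) :=
  (hf.continuous_fderiv (by norm_num)).clm_comp continuous_tangentProj

lemma continuous_lagrangeHess {f : E → ℝ} (hf : ContDiff ℝ 2 f) :
    Continuous (lagrangeHess ι μ f) := by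
  have h1 : Continuous (fderiv ℝ f) := hf.continuous_fderiv (by norm_num)
  have h2 : Continuous (fderiv ℝ (fderiv ℝ f)) :=
    (hf.fderiv_right (m := 1) (by norm_num)).continuous_fderiv (by norm_num)
  have h3 : Continuous fun u => fderiv ℝ f u u / μ := (h1.clm_apply continuous_id).div_const μ
  exact h2.sub (h3.smul continuous_const)

lemma continuous_tangentHess {f : E → ℝ} (hf : ContDiff ℝ 2 f) :
    Continuous (tangentHess ι μ f) := by
  have hflip : Continuous fun T : E →L[ℝ] E →L[ℝ] ℝ => T.flip :=
    (ContinuousLinearMap.flipₗᵢ ℝ E E ℝ).continuous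
  exact hflip.comp ((hflip.comp ((continuous_lagrangeHess hf).clm_comp
    continuous_tangentProj)).clm_comp continuous_tangentProj)

lemma norm_tangentHess_le (hι : ∀ v : E, ‖ι v‖ ≤ ‖v‖) (hμ : 0 < μ) {f : E → ℝ} {K Λ₁ Λ₂ : ℝ}
    {u : E} (hu : ‖u‖ ≤ K) (h₁ : ‖fderiv ℝ f u‖ ≤ Λ₁) (h₂ : ‖fderiv ℝ (fderiv ℝ f) u‖ ≤ Λ₂) :
    ‖tangentHess ι μ f u‖ ≤ (Λ₂ + Λ₁ * K / μ) * (1 + μ⁻¹ * K ^ 2) ^ 2 := by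
  have hK : 0 ≤ K := (norm_nonneg _).trans hu
  have hΛ₁ : 0 ≤ Λ₁ := (norm_nonneg _).trans h₁
  have hΛ₂ : 0 ≤ Λ₂ := (norm_nonneg (fderiv ℝ (fderiv ℝ f) u)).trans h₂
  have hP : ‖tangentProj ι μ u‖ ≤ 1 + μ⁻¹ * K ^ 2 := by
    refine ContinuousLinearMap.opNorm_le_of_unit_norm (by positivity) fun v hv => ?_
    refine (norm_tangentProj_le hι hμ hv.le).trans ?_
    gcongr
  refine ContinuousLinearMap.opNorm_le_bound₂ _ (by positivity) fun v w => ?_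
  have hPx : ∀ v, ‖tangentProj ι μ u v‖ ≤ (1 + μ⁻¹ * K ^ 2) * ‖v‖ :=
    fun v => (tangentProj ι μ u).le_of_opNorm_le hP v
  rw [tangentHess_apply, lagrangeHess_apply]
  set v' := tangentProj ι μ u v
  set w' := tangentProj ι μ u w
  have e1 : ‖fderiv ℝ (fderiv ℝ f) u v' w'‖ ≤ Λ₂ * ‖v'‖ * ‖w'‖ :=
    (fderiv ℝ (fderiv ℝ f) u).le_of_opNorm₂_le_of_le h₂ le_rfl le_rfl
  have e2 : ‖fderiv ℝ f u u‖ ≤ Λ₁ * K := (fderiv ℝ f u).le_of_opNorm_le_of_le h₁ hu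
  have e3 : ‖(inner ℝ (ι v') (ι w') : ℝ)‖ ≤ ‖v'‖ * ‖w'‖ :=
    (norm_inner_le_norm _ _).trans (mul_le_mul (hι _) (hι _) (norm_nonneg _) (norm_nonneg _))
  calc _ ≤ ‖fderiv ℝ (fderiv ℝ f) u v' w'‖ + ‖fderiv ℝ f u u / μ * inner ℝ (ι v') (ι w')‖ :=
        norm_sub_le _ _
    _ ≤ Λ₂ * ‖v'‖ * ‖w'‖ + Λ₁ * K / μ * (‖v'‖ * ‖w'‖) := by
        rw [norm_mul, norm_div, Real.norm_of_nonneg hμ.le]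
        gcongr
    _ = (Λ₂ + Λ₁ * K / μ) * (‖v'‖ * ‖w'‖) := by ring
    _ ≤ (Λ₂ + Λ₁ * K / μ) * (((1 + μ⁻¹ * K ^ 2) * ‖v‖) * ((1 + μ⁻¹ * K ^ 2) * ‖w‖)) := by
        gcongr
        · exact hPx v
        · exact hPx w
    _ = _ := by ring

lemma exists_apply_slide_smul_le (hι : ∀ v : E, ‖ι v‖ ≤ ‖v‖) (hμ : 0 < μ)
    {f : E → ℝ} (hf : ContDiff ℝ 2 f) {K Λ₁ Λ₂ : ℝ} (hK : 0 ≤ K)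
    (h₁ : ∀ u, ‖u‖ ≤ K → ‖fderiv ℝ f u‖ ≤ Λ₁)
    (h₂ : ∀ u, ‖u‖ ≤ K → ‖fderiv ℝ (fderiv ℝ f) u‖ ≤ Λ₂)
    (hosc : ∀ η > 0, ∃ r > 0, ∀ u, ‖u‖ ≤ K → ∀ x, ‖x - u‖ ≤ r →
      ‖fderiv ℝ (fderiv ℝ f) x - fderiv ℝ (fderiv ℝ f) u‖ ≤ η) :
    ∀ η > 0, ∃ r > 0, ∀ u, ‖u‖ ≤ K → ∀ v : E, ‖v‖ ≤ 1 → ∀ s : ℝ, 0 ≤ s → s ≤ r →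
      f (slide ι μ u (tangentProj ι μ u (s • v))) ≤
        f u + (s * tangentGrad ι μ f u v + s ^ 2 / 2 * tangentHess ι μ f u v v) + η * s ^ 2 := by
  intro η hη
  obtain ⟨C, hC, h⟩ := exists_apply_slide_le hι hμ hf hK h₁ h₂
  set b := 1 + μ⁻¹ * K ^ 2 with hb
  have hb0 : 0 < b := by positivity
  obtain ⟨r₁, hr₁, hosc⟩ := hosc (η / (2 * (C * b ^ 2))) (by positivity)
  refine ⟨min (1 / b) (min (r₁ / (C * b)) (η / (2 * (C * b ^ 3)))), by positivity,
    fun u hu v hv s hs0 hs => ?_⟩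
  have hs1 : s * b ≤ 1 := (le_div_iff₀ hb0).1 (hs.trans (min_le_left _ _))
  have hs2 : s * (C * b) ≤ r₁ := (le_div_iff₀ (by positivity)).1
    (hs.trans ((min_le_right _ _).trans (min_le_left _ _)))
  have hs3 : s * (2 * (C * b ^ 3)) ≤ η := (le_div_iff₀ (by positivity)).1
    (hs.trans ((min_le_right _ _).trans (min_le_right _ _)))
  set p := tangentProj ι μ u v with hp
  have hpn : ‖p‖ ≤ b := (norm_tangentProj_le hι hμ hv).trans (by rw [hb]; gcongr)
  have hwn : ‖s • p‖ ≤ s * b := by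
    rw [norm_smul, Real.norm_of_nonneg hs0]; gcongr
  have key := h u (s • p) hu (hwn.trans hs1) (η / (2 * (C * b ^ 2))) (by positivity)
    (fun x hx => hosc u hu x (hx.trans ?_))
  · rw [map_smul, ← hp]
    refine key.trans ?_
    have e1 : fderiv ℝ f u (s • p) = s * tangentGrad ι μ f u v := by simp [tangentGrad, hp]
    have e2 : fderiv ℝ (fderiv ℝ f) u (s • p) (s • p) - fderiv ℝ f u u / μ * ‖ι (s • p)‖ ^ 2
        = s ^ 2 * tangentHess ι μ f u v v := by
      rw [tangentHess_apply, lagrangeHess_apply, ← hp, real_inner_self_eq_norm_sq, map_smul,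
        map_smul, map_smul, norm_smul, mul_pow, Real.norm_eq_abs, sq_abs]
      simp only [smul_apply, smul_eq_mul]
      ring
    have e3 : C * ‖s • p‖ ^ 3 ≤ η / 2 * s ^ 2 := by
      calc C * ‖s • p‖ ^ 3 ≤ C * (s * b) ^ 3 := by gcongr
        _ = s * (2 * (C * b ^ 3)) / 2 * s ^ 2 := by ring
        _ ≤ _ := by gcongr
    have e4 : η / (2 * (C * b ^ 2)) * C * ‖s • p‖ ^ 2 ≤ η / 2 * s ^ 2 := by
      calc _ ≤ η / (2 * (C * b ^ 2)) * C * (s * b) ^ 2 := by gcongr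
        _ = _ := by field_simp
    rw [e1, e2]
    linarith
  · calc C * ‖s • p‖ ≤ C * (s * b) := by gcongr
      _ = s * (C * b) := by ring
      _ ≤ r₁ := hs2

lemma exists_mem_ker_of_one_lt_rank {L : Submodule ℝ E} (hL : 1 < Module.rank ℝ L)
    (f : E →ₗ[ℝ] ℝ) : ∃ w ∈ L, w ≠ 0 ∧ f w = 0 := by
  by_contra! hcon
  have hinj : Function.Injective (f.comp L.subtype) := by
    rw [← LinearMap.ker_eq_bot, LinearMap.ker_eq_bot']
    intro w hw
    by_contra h0
    exact hcon w w.2 (by simpa using h0) hw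
  have := LinearMap.lift_rank_le_of_injective _ hinj
  rw [CommSemiring.rank_self, Cardinal.lift_one, Cardinal.lift_le_one_iff] at this
  exact absurd this (not_le.2 hL)

lemma hasDescent_of_curvature {f : E → ℝ} {u : E} {δ : ℝ} {L : Submodule ℝ E}
    (hLt : ∀ v ∈ L, inner ℝ (ι u) (ι v) = 0)
    (hLn : ∀ v ∈ L, v ≠ 0 → fderiv ℝ (fderiv ℝ f) u v v
      - fderiv ℝ f u u / μ * inner ℝ (ι v) (ι v) < -δ * ‖v‖ ^ 2)
    (hL : 1 < Module.rank ℝ L) :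
    HasDescent δ (tangentGrad ι μ f u) (tangentHess ι μ f u) := by
  refine Or.inr fun g => ?_
  obtain ⟨w, hwL, hw0, hgw⟩ := exists_mem_ker_of_one_lt_rank hL g.toLinearMap
  have hn : ‖‖w‖⁻¹ • w‖ = 1 := by
    rw [norm_smul, norm_inv, norm_norm, inv_mul_cancel₀ (norm_ne_zero_iff.2 hw0)]
  have hm : ‖w‖⁻¹ • w ∈ L := L.smul_mem _ hwL
  refine ⟨‖w‖⁻¹ • w, hn, ?_, ?_⟩
  · rw [map_smul, show g w = 0 from hgw, smul_zero]
  · have := hLn _ hm (by rw [← norm_ne_zero_iff, hn]; exact one_ne_zero)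
    rw [tangentHess_apply, tangentProj_eq_self (hLt _ hm), lagrangeHess_apply]
    rw [hn] at this
    linarith

lemma hasDescent_of_grad {f : E → ℝ} {u v : E} {δ : ℝ} (hv : inner ℝ (ι u) (ι v) = 0)
    (hv1 : ‖v‖ ≤ 1) (h : δ < |fderiv ℝ f u v|) :
    HasDescent δ (tangentGrad ι μ f u) (tangentHess ι μ f u) := by
  left
  have e : tangentGrad ι μ f u v = fderiv ℝ f u v := by
    simp [tangentGrad, tangentProj_eq_self hv]
  rcases lt_abs.1 h with h | h
  · exact ⟨-v, by simpa using hv1, by rw [map_neg, e]; linarith⟩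
  · exact ⟨v, hv1, by rw [e]; linarith⟩

/-- Deformation below a level on `{‖ι u‖ ^ 2 = μ}` when no point near the level is almost critical
with approximate Morse index at most one. -/
theorem exists_curve_below (hι : ∀ v : E, ‖ι v‖ ≤ ‖v‖) (hμ : 0 < μ)
    {f : E → ℝ} (hf : ContDiff ℝ 2 f) {K Λ₁ Λ₂ : ℝ} (hK : 0 ≤ K)
    (h₁ : ∀ u, ‖u‖ ≤ K → ‖fderiv ℝ f u‖ ≤ Λ₁)
    (h₂ : ∀ u, ‖u‖ ≤ K → ‖fderiv ℝ (fderiv ℝ f) u‖ ≤ Λ₂)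
    (hosc : ∀ η > 0, ∃ r > 0, ∀ u, ‖u‖ ≤ K → ∀ x, ‖x - u‖ ≤ r →
      ‖fderiv ℝ (fderiv ℝ f) x - fderiv ℝ (fderiv ℝ f) u‖ ≤ η)
    {c δ : ℝ} (hδ : 0 < δ)
    (hD : ∀ u, ‖ι u‖ ^ 2 = μ → ‖u‖ ≤ K → |f u - c| ≤ δ →
      (∃ v, inner ℝ (ι u) (ι v) = 0 ∧ ‖v‖ ≤ 1 ∧ δ < |fderiv ℝ f u v|) ∨
      ∃ L : Submodule ℝ E, (∀ v ∈ L, inner ℝ (ι u) (ι v) = 0) ∧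
        (∀ v ∈ L, v ≠ 0 → fderiv ℝ (fderiv ℝ f) u v v
          - fderiv ℝ f u u / μ * inner ℝ (ι v) (ι v) < -δ * ‖v‖ ^ 2) ∧
        1 < Module.rank ℝ L) :
    ∃ ε > 0, ∀ ε' > 0, ∀ g : ℝ → E, Continuous g → (∀ t, ‖ι (g t)‖ ^ 2 = μ) →
      (∀ t, f (g t) ≤ c + ε) → (∀ t, c - ε' < f (g t) → ‖g t‖ ≤ K) →
      ∀ a b, f (g a) < c → f (g b) < c →
      ∃ γ : ℝ → E, Continuous γ ∧ (∀ t, ‖ι (γ t)‖ ^ 2 = μ) ∧ γ 0 = g a ∧ γ 1 = g b ∧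
        ∀ t, f (γ t) < c := by
  let X := {u : E // ‖ι u‖ ^ 2 = μ}
  obtain ⟨ε, hε, H⟩ := exists_joinedIn_sublevel (X := X) (E := E) (f := fun x => f x.1)
    (hf.continuous.comp continuous_subtype_val)
    (ℓ := fun x => tangentGrad ι μ f x.1)
    ((continuous_tangentGrad hf).comp continuous_subtype_val)
    (Q := fun x => tangentHess ι μ f x.1)
    ((continuous_tangentHess hf).comp continuous_subtype_val)
    (Θ := fun x v => ⟨slide ι μ x.1 (tangentProj ι μ x.1 v),
      norm_slide hμ x.2 (inner_tangentProj hμ x.2 v)⟩)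
    (by
      refine Continuous.subtype_mk ((continuous_slide hμ).comp (f := fun p : X × E =>
        (p.1.1, tangentProj ι μ p.1.1 p.2)) ?_) _
      exact (continuous_subtype_val.comp continuous_fst).prodMk
        ((continuous_tangentProj.comp (continuous_subtype_val.comp continuous_fst)).clm_apply
          continuous_snd))
    (fun x => Subtype.ext (by simp [slide_zero]))
    (D := {x | ‖x.1‖ ≤ K}) (c := c) hδ
    (fun x hx => norm_tangentHess_le hι hμ hx (h₁ _ hx) (h₂ _ hx))
    (fun η hη => by
      obtain ⟨r, hr, h⟩ := exists_apply_slide_smul_le hι hμ hf hK h₁ h₂ hosc η hη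
      exact ⟨r, hr, fun x hx v hv s hs hsr => h x.1 hx v hv s hs hsr⟩)
    (fun x hx hxc => by
      rcases hD x.1 x.2 hx hxc with ⟨v, hv, hv1, h⟩ | ⟨L, hLt, hLn, hL⟩
      · exact hasDescent_of_grad hv hv1 h
      · exact hasDescent_of_curvature hLt hLn hL)
  refine ⟨ε, hε, fun ε' hε' g hg hgμ hgc hgK a b ha hb => ?_⟩
  obtain ⟨p, hp⟩ := H ε' hε' (fun t => ⟨g t, hgμ t⟩) (hg.subtype_mk _) hgc hgK a b ha hb
  refine ⟨fun t => (p.extend t).1, continuous_subtype_val.comp p.continuous_extend,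
    fun t => (p.extend t).2, by simp, by simp, fun t => ?_⟩
  exact hp _

end ConstraintDeformation

section Minimax

variable {E H : Type*} [NormedAddCommGroup E] [InnerProductSpace ℝ E]
  [NormedAddCommGroup H] [InnerProductSpace ℝ H]

/-- Curves on `{‖ι u‖ ^ 2 = μ}` from `w₁` to `w₂`. -/
def constraintPaths (ι : E →L[ℝ] H) (μ : ℝ) (w₁ w₂ : E) : Set (ℝ → E) :=
  {γ | ContinuousOn γ (Icc 0 1) ∧ MapsTo γ (Icc 0 1) {v : E | ‖ι v‖ ^ 2 = μ} ∧
    γ 0 = w₁ ∧ γ 1 = w₂}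

/-- The mountain pass level of `f` over curves on `{‖ι u‖ ^ 2 = μ}` from `w₁` to `w₂`. -/
noncomputable def minimaxLevel (ι : E →L[ℝ] H) (μ : ℝ) (w₁ w₂ : E) (f : E → ℝ) : ℝ :=
  sInf {m : ℝ | ∃ γ ∈ constraintPaths ι μ w₁ w₂, m = sSup ((fun t => f (γ t)) '' Icc 0 1)}

variable {ι : E →L[ℝ] H} {μ : ℝ} {w₁ w₂ : E}

lemma constraintPaths_nonempty (hE : ¬ FiniteDimensional ℝ E) (hι : Function.Injective ι)
    (hμ : 0 < μ) (hw₁ : ‖ι w₁‖ ^ 2 = μ) (hw₂ : ‖ι w₂‖ ^ 2 = μ) :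
    (constraintPaths ι μ w₁ w₂).Nonempty := by
  have hrank : 1 < Module.rank ℝ E :=
    Cardinal.one_lt_aleph0.trans_le (not_lt.1 fun h => hE (Module.rank_lt_aleph0_iff.1 h))
  have hne : ∀ w : E, ‖ι w‖ ^ 2 = μ → w ∈ ({0}ᶜ : Set E) := by
    rintro w hw rfl
    simp at hw
    exact hμ.ne hw
  obtain ⟨p, hp⟩ := (isPathConnected_compl_singleton_of_one_lt_rank hrank (0 : E)).joinedIn
    w₁ (hne _ hw₁) w₂ (hne _ hw₂)
  have hιp : ∀ x : E, x ∈ ({0}ᶜ : Set E) → ‖ι x‖ ≠ 0 := fun x hx h =>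
    hx (hι (by rw [norm_eq_zero.1 h, map_zero]))
  have hs : ∀ w : E, ‖ι w‖ ^ 2 = μ → (Real.sqrt μ / ‖ι w‖) • w = w := by
    intro w hw
    rw [← hw, Real.sqrt_sq (norm_nonneg _), div_self (hιp w (hne w hw)), one_smul]
  refine ⟨fun t => (Real.sqrt μ / ‖ι (p.extend t)‖) • p.extend t, ?_, ?_, ?_, ?_⟩
  · refine Continuous.continuousOn (Continuous.smul ?_ p.continuous_extend)
    exact continuous_const.div (ι.continuous.comp p.continuous_extend).norm
      fun t => hιp _ (hp _)
  · intro t _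
    have h0 := hιp (p.extend t) (hp _)
    simp only [mem_ofPred_eq, map_smul, norm_smul, norm_div, norm_norm,
      Real.norm_of_nonneg (Real.sqrt_nonneg μ)]
    rw [div_mul_cancel₀ _ h0, Real.sq_sqrt hμ.le]
  · simpa using hs w₁ hw₁
  · simpa using hs w₂ hw₂

lemma bddAbove_image_of_mem_constraintPaths {f : E → ℝ} (hf : Continuous f) {γ : ℝ → E}
    (hγ : γ ∈ constraintPaths ι μ w₁ w₂) : BddAbove ((fun t => f (γ t)) '' Icc 0 1) :=
  (isCompact_Icc.image_of_continuousOn (hf.comp_continuousOn hγ.1)).bddAbove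

lemma minimaxLevel_lt {f : E → ℝ} (hf : Continuous f) {γ : ℝ → E}
    (hγ : γ ∈ constraintPaths ι μ w₁ w₂) {m : ℝ} (h : ∀ t ∈ Icc (0 : ℝ) 1, f (γ t) < m) :
    minimaxLevel ι μ w₁ w₂ f < m := by
  obtain ⟨t, ht, hmax⟩ := isCompact_Icc.exists_isMaxOn (nonempty_Icc.2 (zero_le_one' ℝ))
    (hf.comp_continuousOn hγ.1)
  have hbdd : BddBelow {m : ℝ | ∃ γ ∈ constraintPaths ι μ w₁ w₂,
      m = sSup ((fun t => f (γ t)) '' Icc 0 1)} := by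
    refine ⟨f w₁, ?_⟩
    rintro _ ⟨γ, hγ, rfl⟩
    exact le_csSup (bddAbove_image_of_mem_constraintPaths hf hγ)
      ⟨0, by simp, by simp only [hγ.2.2.1]⟩
  refine (csInf_le hbdd ⟨γ, hγ, rfl⟩).trans_lt ((csSup_le ?_ ?_).trans_lt (h t ht))
  · exact (nonempty_Icc.2 zero_le_one).image _
  · rintro _ ⟨s, hs, rfl⟩
    exact hmax hs

lemma exists_lt_of_minimaxLevel_lt (hne : (constraintPaths ι μ w₁ w₂).Nonempty) {f : E → ℝ}
    (hf : Continuous f) {m : ℝ} (h : minimaxLevel ι μ w₁ w₂ f < m) :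
    ∃ γ ∈ constraintPaths ι μ w₁ w₂, ∀ t ∈ Icc (0 : ℝ) 1, f (γ t) < m := by
  obtain ⟨γ₀, hγ₀⟩ := hne
  obtain ⟨_, ⟨γ, hγ, rfl⟩, hlt⟩ := exists_lt_of_csInf_lt
    (s := {m : ℝ | ∃ γ ∈ constraintPaths ι μ w₁ w₂, m = sSup ((fun t => f (γ t)) '' Icc 0 1)})
    ⟨_, γ₀, hγ₀, rfl⟩ h
  exact ⟨γ, hγ, fun t ht => (le_csSup (bddAbove_image_of_mem_constraintPaths hf hγ)
    ⟨t, ht, rfl⟩).trans_lt hlt⟩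

lemma minimaxLevel_mono (hne : (constraintPaths ι μ w₁ w₂).Nonempty) {f g : E → ℝ}
    (hf : Continuous f) (hg : Continuous g) (hfg : ∀ u, f u ≤ g u) :
    minimaxLevel ι μ w₁ w₂ f ≤ minimaxLevel ι μ w₁ w₂ g := by
  refine le_of_forall_gt fun m hm => ?_
  obtain ⟨γ, hγ, h⟩ := exists_lt_of_minimaxLevel_lt hne hg hm
  exact minimaxLevel_lt hf hγ fun t ht => (hfg _).trans_lt (h t ht)

lemma exists_norm_le_of_coercive {F : Type*} [Norm F] {A B : F → ℝ}
    (hcoer : Tendsto A (comap (fun u : F => ‖u‖) atTop) atTop ∨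
      Tendsto B (comap (fun u : F => ‖u‖) atTop) atTop) (a b : ℝ) :
    ∃ K, 0 ≤ K ∧ ∀ u, A u ≤ a → B u ≤ b → ‖u‖ ≤ K := by
  have key : ∀ (G : F → ℝ) (m : ℝ), Tendsto G (comap (fun u : F => ‖u‖) atTop) atTop →
      ∃ K, 0 ≤ K ∧ ∀ u, G u ≤ m → ‖u‖ ≤ K := by
    intro G m hG
    obtain ⟨K, hK⟩ := eventually_atTop.1 (eventually_comap.1 (hG.eventually_gt_atTop m))
    refine ⟨max K 0, le_max_right _ _, fun u hu => ?_⟩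
    by_contra! hlt
    exact absurd (hK ‖u‖ ((le_max_left _ _).trans hlt.le) u rfl) (not_lt.2 hu)
  rcases hcoer with h | h
  · obtain ⟨K, hK, hKu⟩ := key A a h
    exact ⟨K, hK, fun u hu _ => hKu u hu⟩
  · obtain ⟨K, hK, hKu⟩ := key B b h
    exact ⟨K, hK, fun u _ hu => hKu u hu⟩

/-- The monotonicity trick: at a point of differentiability of the level, near-optimal curves are
bounded where the functional is close to the level. -/
lemma exists_bounded_curves (hne : (constraintPaths ι μ w₁ w₂).Nonempty) {A B : E → ℝ}
    (hA : Continuous A) (hB : Continuous B) (hBpos : ∀ u, 0 ≤ B u)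
    (hcoer : Tendsto A (comap (fun u : E => ‖u‖) atTop) atTop ∨
      Tendsto B (comap (fun u : E => ‖u‖) atTop) atTop) {c : ℝ → ℝ}
    (hc : ∀ ρ, c ρ = minimaxLevel ι μ w₁ w₂ fun u => A u - ρ * B u) {ρ : ℝ} (hρ : 0 ≤ ρ)
    (hd : DifferentiableAt ℝ c ρ) :
    ∃ K, 0 ≤ K ∧ ∀ ε > 0, ∃ ε' > 0, ∃ γ ∈ constraintPaths ι μ w₁ w₂, ∀ t ∈ Icc (0 : ℝ) 1,
      A (γ t) - ρ * B (γ t) ≤ c ρ + ε ∧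
      (c ρ - ε' < A (γ t) - ρ * B (γ t) → ‖γ t‖ ≤ K) := by
  obtain ⟨D, hD, hO⟩ := hd.isBigO_sub.exists_pos
  obtain ⟨h₀, hh₀, hO⟩ := Metric.eventually_nhds_iff.1 hO.bound
  obtain ⟨K, hK, hKu⟩ := exists_norm_le_of_coercive hcoer (c ρ + (D + 1) + ρ * (D + 2)) (D + 2)
  refine ⟨K, hK, fun ε hε => ?_⟩
  set h := min (h₀ / 2) (min 1 (ε / (D + 1))) with hh
  have hpos : 0 < h := by positivity
  have hlt : h < h₀ := (min_le_left _ _).trans_lt (half_lt_self hh₀)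
  have hle : h ≤ 1 := (min_le_right _ _).trans (min_le_left _ _)
  have hhε : h * (D + 1) ≤ ε :=
    (le_div_iff₀ (by positivity)).1 ((min_le_right _ _).trans (min_le_right _ _))
  have hcρ : c (ρ - h) ≤ c ρ + D * h := by
    have := hO (y := ρ - h) (by rw [Real.dist_eq]; simpa [abs_of_pos hpos] using hlt)
    have e : ‖ρ - h - ρ‖ = h := by rw [Real.norm_eq_abs]; simp [abs_of_pos hpos]
    rw [e] at this
    linarith [(le_abs_self _).trans this]
  obtain ⟨γ, hγ, hγt⟩ := exists_lt_of_minimaxLevel_lt hne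
    (f := fun u => A u - (ρ - h) * B u) (hA.sub (continuous_const.mul hB)) (m := c (ρ - h) + h) (by rw [← hc]; linarith)
  refine ⟨h, hpos, γ, hγ, fun t ht => ?_⟩
  have h1 := hγt t ht
  have h2 := hBpos (γ t)
  have h3 : 0 ≤ h * B (γ t) := by positivity
  refine ⟨by nlinarith, fun h4 => ?_⟩
  have hB' : B (γ t) ≤ D + 2 := by
    refine le_of_mul_le_mul_left ?_ hpos
    nlinarith
  refine hKu _ ?_ hB'
  have : ρ * B (γ t) ≤ ρ * (D + 2) := by gcongr
  nlinarith

/-- A near-critical point of approximate Morse index at most one, from near-optimal curves that are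
bounded close to the minimax level. -/
lemma exists_almost_critical (hι : ∀ v : E, ‖ι v‖ ≤ ‖v‖) (hμ : 0 < μ)
    {f : E → ℝ} (hf : ContDiff ℝ 2 f) {α : ℝ} (hα : 0 < α)
    (hHolder : ∀ R > (0 : ℝ), ∃ M > (0 : ℝ), ∀ u₁ u₂ : E, ‖u₁‖ ≤ R → ‖u₂‖ ≤ R →
      ‖fderiv ℝ f u₁ - fderiv ℝ f u₂‖ ≤ M * ‖u₁ - u₂‖ ^ α ∧
      ‖fderiv ℝ (fderiv ℝ f) u₁ - fderiv ℝ (fderiv ℝ f) u₂‖ ≤ M * ‖u₁ - u₂‖ ^ α)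
    {c : ℝ} (hc : c = minimaxLevel ι μ w₁ w₂ f) (hw₁ : f w₁ < c) (hw₂ : f w₂ < c)
    {K : ℝ} (hK : 0 ≤ K)
    (hγ : ∀ ε > 0, ∃ ε' > 0, ∃ γ ∈ constraintPaths ι μ w₁ w₂, ∀ t ∈ Icc (0 : ℝ) 1,
      f (γ t) ≤ c + ε ∧ (c - ε' < f (γ t) → ‖γ t‖ ≤ K))
    {δ : ℝ} (hδ : 0 < δ) :
    ∃ u, ‖ι u‖ ^ 2 = μ ∧ ‖u‖ ≤ K ∧ |f u - c| ≤ δ ∧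
      (∀ v, inner ℝ (ι u) (ι v) = 0 → ‖v‖ ≤ 1 → |fderiv ℝ f u v| ≤ δ) ∧
      ∀ L : Submodule ℝ E, (∀ v ∈ L, inner ℝ (ι u) (ι v) = 0) →
        (∀ v ∈ L, v ≠ 0 → fderiv ℝ (fderiv ℝ f) u v v
          - fderiv ℝ f u u / μ * inner ℝ (ι v) (ι v) < -δ * ‖v‖ ^ 2) →
        Module.rank ℝ L ≤ 1 := by
  by_contra! hcon
  obtain ⟨M, hM, hMu⟩ := hHolder (K + 1) (by positivity)
  have h0 : ‖(0 : E)‖ ≤ K + 1 := by rw [norm_zero]; positivity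
  have hpow : ∀ u : E, ‖u‖ ≤ K → M * ‖u - 0‖ ^ α ≤ M * K ^ α := fun u hu => by
    rw [sub_zero]; gcongr
  have h₁ : ∀ u, ‖u‖ ≤ K → ‖fderiv ℝ f u‖ ≤ M * K ^ α + ‖fderiv ℝ f 0‖ := fun u hu => by
    have h1 := (hMu u 0 (by linarith) h0).1
    have h2 := norm_sub_norm_le (fderiv ℝ f u) (fderiv ℝ f 0)
    linarith [hpow u hu]
  have h₂ : ∀ u, ‖u‖ ≤ K → ‖fderiv ℝ (fderiv ℝ f) u‖ ≤
      M * K ^ α + ‖fderiv ℝ (fderiv ℝ f) 0‖ := fun u hu => by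
    have h1 := (hMu u 0 (by linarith) h0).2
    have h2 := norm_sub_norm_le (fderiv ℝ (fderiv ℝ f) u) (fderiv ℝ (fderiv ℝ f) 0)
    linarith [hpow u hu]
  have hosc : ∀ η > 0, ∃ r > 0, ∀ u, ‖u‖ ≤ K → ∀ x, ‖x - u‖ ≤ r →
      ‖fderiv ℝ (fderiv ℝ f) x - fderiv ℝ (fderiv ℝ f) u‖ ≤ η := by
    intro η hη
    refine ⟨min 1 ((η / M) ^ α⁻¹), by positivity, fun u hu x hx => ?_⟩
    have hx1 : ‖x‖ ≤ K + 1 := by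
      have := norm_sub_norm_le x u
      linarith [hx.trans (min_le_left _ _)]
    refine (hMu x u hx1 (by linarith)).2.trans ?_
    calc M * ‖x - u‖ ^ α ≤ M * ((η / M) ^ α⁻¹) ^ α := by
          gcongr
          exact hx.trans (min_le_right _ _)
      _ = η := by
          rw [Real.rpow_inv_rpow (by positivity) hα.ne', mul_div_cancel₀ _ hM.ne']
  obtain ⟨ε, hε, H⟩ := exists_curve_below hι hμ hf hK h₁ h₂ hosc hδ (c := c)
    (fun u hu huK huc => by
      by_cases hg : ∀ v, inner ℝ (ι u) (ι v) = 0 → ‖v‖ ≤ 1 → |fderiv ℝ f u v| ≤ δ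
      · exact Or.inr (hcon u hu huK huc hg)
      · push Not at hg
        exact Or.inl hg)
  obtain ⟨ε', hε', γ, hγP, hγt⟩ := hγ ε hε
  let q : ℝ → ℝ := fun t => projIcc (0 : ℝ) 1 zero_le_one t
  have hq : ∀ t, q t ∈ Icc (0 : ℝ) 1 := fun t => (projIcc (0 : ℝ) 1 zero_le_one t).2
  have hq0 : q 0 = 0 := by simp [q]
  have hq1 : q 1 = 1 := by simp [q]
  obtain ⟨γ', hγ', hγ'μ, hγ'0, hγ'1, hγ'c⟩ := H ε' hε' (fun t => γ (q t))
    (hγP.1.comp_continuous (continuous_subtype_val.comp continuous_projIcc) hq)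
    (fun t => hγP.2.1 (hq t)) (fun t => (hγt _ (hq t)).1) (fun t => (hγt _ (hq t)).2)
    0 1 (by simpa [hq0, hγP.2.2.1] using hw₁) (by simpa [hq1, hγP.2.2.2] using hw₂)
  have := minimaxLevel_lt hf.continuous (γ := γ') (w₁ := w₁) (w₂ := w₂) (ι := ι) (μ := μ)
    ⟨hγ'.continuousOn, fun t _ => hγ'μ t, by rw [hγ'0, hq0, hγP.2.2.1],
      by rw [hγ'1, hq1, hγP.2.2.2]⟩ fun t _ => hγ'c t
  exact this.ne hc.symm

end Minimax

/-- Theorem 2.3 of the paper (Borthwick–Chang–Jeanjean–Soave): parametrized constrained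
mountain-pass theorem producing, for a.e. value of the parameter, a bounded Palais–Smale
sequence at the mountain-pass level with approximate Morse index at most 1. -/
theorem stmt_2
    {E H : Type*} [NormedAddCommGroup E] [InnerProductSpace ℝ E] [CompleteSpace E]
    [NormedAddCommGroup H] [InnerProductSpace ℝ H] [CompleteSpace H]
    (hdimE : ¬ FiniteDimensional ℝ E) (hdimH : ¬ FiniteDimensional ℝ H)
    (ι : E →L[ℝ] H) (hιinj : Function.Injective ι) (hι1 : ∀ v : E, ‖ι v‖ ≤ ‖v‖)
    (I : Set ℝ) (hI : I ⊆ Set.Ioi 0) (hIint : I.OrdConnected)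
    (μ : ℝ) (hμ : 0 < μ)
    (A B : E → ℝ) (hA : ContDiff ℝ 2 A) (hB : ContDiff ℝ 2 B)
    (Φ : ℝ → E → ℝ) (hΦ : ∀ ρ u, Φ ρ u = A u - ρ * B u)
    (hBpos : ∀ u, 0 ≤ B u)
    (hcoer : Tendsto A (Filter.comap (fun u : E => ‖u‖) Filter.atTop) Filter.atTop ∨
             Tendsto B (Filter.comap (fun u : E => ‖u‖) Filter.atTop) Filter.atTop)
    (α : ℝ) (hα : α ∈ Set.Ioc (0 : ℝ) 1)
    (hHolder : ∀ ρ ∈ I, ∀ R > (0 : ℝ), ∃ M > (0 : ℝ), ∀ u₁ u₂ : E,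
      ‖u₁‖ ≤ R → ‖u₂‖ ≤ R →
      ‖fderiv ℝ (Φ ρ) u₁ - fderiv ℝ (Φ ρ) u₂‖ ≤ M * ‖u₁ - u₂‖ ^ α ∧
      ‖fderiv ℝ (fderiv ℝ (Φ ρ)) u₁ - fderiv ℝ (fderiv ℝ (Φ ρ)) u₂‖ ≤ M * ‖u₁ - u₂‖ ^ α)
    (w₁ w₂ : E) (hw₁ : ‖ι w₁‖ ^ 2 = μ) (hw₂ : ‖ι w₂‖ ^ 2 = μ)
    (c : ℝ → ℝ)
    (hc : ∀ ρ : ℝ, c ρ = sInf {m : ℝ | ∃ γ : ℝ → E,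
      ContinuousOn γ (Set.Icc 0 1) ∧
      Set.MapsTo γ (Set.Icc 0 1) {v : E | ‖ι v‖ ^ 2 = μ} ∧
      γ 0 = w₁ ∧ γ 1 = w₂ ∧
      m = sSup ((fun t => Φ ρ (γ t)) '' Set.Icc 0 1)})
    (hmp : ∀ ρ ∈ I, max (Φ ρ w₁) (Φ ρ w₂) < c ρ) :
    ∀ᵐ ρ ∂(volume : Measure ℝ), ρ ∈ I →
      ∃ (u : ℕ → E) (ζ : ℕ → ℝ),
        (∀ n, ‖ι (u n)‖ ^ 2 = μ) ∧
        (∀ n, 0 < ζ n) ∧ Tendsto ζ atTop (nhds 0) ∧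
        -- (i) Φ_ρ(u_n) → c_ρ
        Tendsto (fun n => Φ ρ (u n)) atTop (nhds (c ρ)) ∧
        -- (ii) the norm of the constrained gradient tends to 0
        (∀ ε > (0 : ℝ), ∃ N : ℕ, ∀ n ≥ N, ∀ v : E,
          (inner ℝ (ι (u n)) (ι v) : ℝ) = 0 → ‖v‖ ≤ 1 → |fderiv ℝ (Φ ρ) (u n) v| ≤ ε) ∧
        -- (iii) {u_n} is bounded in E
        (∃ C : ℝ, ∀ n, ‖u n‖ ≤ C) ∧
        -- (iv) the approximate Morse index satisfies m̃_{ζ_n}(u_n) ≤ 1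
        (∀ n, ∀ L : Submodule ℝ E,
          (∀ φ ∈ L, (inner ℝ (ι (u n)) (ι φ) : ℝ) = 0) →
          (∀ φ ∈ L, φ ≠ 0 →
            fderiv ℝ (fderiv ℝ (Φ ρ)) (u n) φ φ
              - (fderiv ℝ (Φ ρ) (u n) (u n) / ‖ι (u n)‖ ^ 2) * (inner ℝ (ι φ) (ι φ) : ℝ)
              < -(ζ n) * ‖φ‖ ^ 2) →
          Module.rank ℝ L ≤ 1) := by
  obtain ⟨hα, -⟩ := hα
  have hne := constraintPaths_nonempty hdimE hιinj hμ hw₁ hw₂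
  have hΦ' : ∀ ρ, Φ ρ = fun u => A u - ρ * B u := fun ρ => funext (hΦ ρ)
  have hcl : ∀ ρ, c ρ = minimaxLevel ι μ w₁ w₂ (Φ ρ) := by
    intro ρ
    simp only [hc ρ, minimaxLevel, constraintPaths, mem_ofPred_eq, and_assoc]
  have hcl' : ∀ ρ, c ρ = minimaxLevel ι μ w₁ w₂ fun u => A u - ρ * B u := fun ρ => by
    rw [hcl, hΦ']
  have hcont : ∀ ρ, Continuous fun u => A u - ρ * B u := fun ρ =>
    hA.continuous.sub (continuous_const.mul hB.continuous)
  have hanti : Antitone c := fun ρ₁ ρ₂ h => by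
    rw [hcl', hcl']
    refine minimaxLevel_mono hne (hcont _) (hcont _) fun u => ?_
    have := mul_le_mul_of_nonneg_right h (hBpos u)
    linarith
  filter_upwards [hanti.neg.ae_differentiableAt] with ρ hdiff hρ
  have hd : DifferentiableAt ℝ c ρ := by simpa using hdiff.neg
  obtain ⟨K, hK, hγ⟩ := exists_bounded_curves hne hA.continuous hB.continuous hBpos hcoer hcl'
    (le_of_lt (hI hρ)) hd
  have hΦC : ContDiff ℝ 2 (Φ ρ) := by
    rw [hΦ']
    exact hA.sub (contDiff_const.mul hB)
  have hδ : ∀ n : ℕ, (0 : ℝ) < 1 / ((n : ℝ) + 1) := fun n => Nat.one_div_pos_of_nat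
  choose u hu huK huc hgrad hmorse using fun n : ℕ =>
    exists_almost_critical hι1 hμ hΦC hα (hHolder ρ hρ) (hcl ρ)
      ((le_max_left _ _).trans_lt (hmp ρ hρ)) ((le_max_right _ _).trans_lt (hmp ρ hρ)) hK
      (by simpa only [hΦ] using hγ) (hδ n)
  have hζ : Tendsto (fun n : ℕ => 1 / ((n : ℝ) + 1)) atTop (nhds 0) :=
    tendsto_one_div_add_atTop_nhds_zero_nat
  refine ⟨u, fun n => 1 / ((n : ℝ) + 1), hu, hδ, hζ, ?_, fun ε hε => ?_, ⟨K, huK⟩,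
    fun n L hL hLn => hmorse n L hL ?_⟩
  · exact tendsto_iff_norm_sub_tendsto_zero.2
      (squeeze_zero (fun _ => norm_nonneg _) huc hζ)
  · obtain ⟨N, hN⟩ := eventually_atTop.1 (hζ.eventually_le_const hε)
    exact ⟨N, fun n hn v hv hv1 => (hgrad n v hv hv1).trans (hN n hn)⟩
  · simpa only [hu n] using hLn
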